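/- Let k be a nonzero integer. Then every finite simple graph G is an induced subgraph of some connected finite simple graph that has independence roots at i/k and −i/k. -/

import Mathlib

open scoped Classical
open Polynomial

/-- `s` is an independent set of the simple graph `G`. -/
def SimpleGraph.IsIndepFinset {V : Type} (G : SimpleGraph V) (s : Finset V) : Prop :=
  ∀ u ∈ s, ∀ v ∈ s, ¬ G.Adj u v

/-- The independence polynomial of `G`, as a polynomial over `ℂ`:
`I(G,x) = ∑_k s_k x^k` where `s_k` is the number of independent sets of cardinality `k`. -/
noncomputable def indepPoly {V : Type} [Fintype V] (G : SimpleGraph V) : Polynomial ℂ :=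
  ∑ s ∈ Finset.univ.filter (fun s : Finset V => G.IsIndepFinset s), (X : Polynomial ℂ) ^ s.card

/-- The independence number of `G`. -/
noncomputable def indepNum {V : Type} [Fintype V] (G : SimpleGraph V) : ℕ :=
  (Finset.univ.filter (fun s : Finset V => G.IsIndepFinset s)).sup Finset.card

/-- The join `G + H` of two graphs: their disjoint union together with
all edges between the two parts. -/
def graphJoin {α β : Type} (G : SimpleGraph α) (H : SimpleGraph β) : SimpleGraph (α ⊕ β) where
  Adj x y :=
    match x, y with
    | Sum.inl a, Sum.inl b => G.Adj a b
    | Sum.inr a, Sum.inr b => H.Adj a b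
    | Sum.inl _, Sum.inr _ => True
    | Sum.inr _, Sum.inl _ => True
  symm := by
    constructor
    rintro (a | a) (b | b) h
    · exact G.symm.symm _ _ h
    · trivial
    · trivial
    · exact H.symm.symm _ _ h
  loopless := by
    constructor
    rintro (a | a) h
    · exact G.loopless.irrefl a h
    · exact H.loopless.irrefl a h

/-- `mK_n` : the disjoint union of `m` copies of the complete graph `K_n`. -/
def mClique (m n : ℕ) : SimpleGraph (Fin m × Fin n) where
  Adj x y := x.1 = y.1 ∧ x ≠ y
  symm := by constructor; rintro x y ⟨h1, h2⟩; exact ⟨h1.symm, h2.symm⟩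
  loopless := by constructor; rintro x ⟨_, h⟩; exact h rfl

/-- The lexicographic product `G[H]`. -/
def lexProd {α β : Type} (G : SimpleGraph α) (H : SimpleGraph β) : SimpleGraph (α × β) where
  Adj x y := G.Adj x.1 y.1 ∨ (x.1 = y.1 ∧ H.Adj x.2 y.2)
  symm := by
    constructor
    rintro x y (h | ⟨h1, h2⟩)
    · exact Or.inl (G.symm.symm _ _ h)
    · exact Or.inr ⟨h1.symm, H.symm.symm _ _ h2⟩
  loopless := by
    constructor
    rintro x (h | ⟨-, h⟩)
    · exact G.loopless.irrefl _ h
    · exact H.loopless.irrefl _ h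

/-- The corona `G ∘ H`: for each vertex `v` of `G`, add a new copy of `H`
joined completely to `v`. -/
def corona {α β : Type} (G : SimpleGraph α) (H : SimpleGraph β) : SimpleGraph (α ⊕ α × β) where
  Adj x y :=
    match x, y with
    | Sum.inl a, Sum.inl b => G.Adj a b
    | Sum.inl a, Sum.inr b => a = b.1
    | Sum.inr a, Sum.inl b => b = a.1
    | Sum.inr a, Sum.inr b => a.1 = b.1 ∧ H.Adj a.2 b.2
  symm := by
    constructor
    rintro (a | a) (b | b) h
    · exact G.symm.symm _ _ h
    · exact h
    · exact h
    · exact ⟨h.1.symm, H.symm.symm _ _ h.2⟩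
  loopless := by
    constructor
    rintro (a | a) h
    · exact G.loopless.irrefl a h
    · exact H.loopless.irrefl a.2 h.2

theorem indepPoly_eval {V : Type} [Fintype V] (G : SimpleGraph V) (z : ℂ) :
    (indepPoly G).eval z =
      ∑ s ∈ Finset.univ.filter (fun s : Finset V => G.IsIndepFinset s), z ^ s.card := by
  simp [indepPoly, eval_finsetSum]

theorem indepPoly_eval_conj {V : Type} [Fintype V] (G : SimpleGraph V) (z : ℂ) :
    (indepPoly G).eval (starRingEnd ℂ z) = starRingEnd ℂ ((indepPoly G).eval z) := by
  simp [indepPoly_eval]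

theorem indepPoly_eval_iso {V W : Type} [Fintype V] [Fintype W] {G : SimpleGraph V}
    {H : SimpleGraph W} (e : G ≃g H) (z : ℂ) :
    (indepPoly G).eval z = (indepPoly H).eval z := by
  rw [indepPoly_eval, indepPoly_eval]
  refine Finset.sum_equiv e.toEquiv.finsetCongr ?_ ?_
  · intro s
    rw [Finset.mem_filter_univ, Finset.mem_filter_univ]
    simp only [SimpleGraph.IsIndepFinset, Equiv.finsetCongr_apply, Finset.forall_mem_map]
    exact forall₄_congr fun _ _ _ _ => not_congr e.map_adj_iff.symm
  · intro s _
    simp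

theorem graphJoin_indepPoly_eval {α β : Type} [Fintype α] [Fintype β] (G : SimpleGraph α)
    (H : SimpleGraph β) (z : ℂ) :
    (indepPoly (graphJoin G H)).eval z =
      (indepPoly G).eval z + (indepPoly H).eval z - 1 := by
  simp only [indepPoly_eval]
  have hunion : Finset.univ.filter (fun s => (graphJoin G H).IsIndepFinset s) =
      (Finset.univ.filter fun s => G.IsIndepFinset s).map
        (Finset.mapEmbedding Function.Embedding.inl).toEmbedding ∪
      (Finset.univ.filter fun s => H.IsIndepFinset s).map
        (Finset.mapEmbedding Function.Embedding.inr).toEmbedding := by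
    ext S
    simp only [Finset.mem_filter, Finset.mem_univ, true_and, Finset.mem_union, Finset.mem_map,
      RelEmbedding.coe_toEmbedding, Finset.mapEmbedding_apply]
    constructor
    · intro hS
      by_cases h : ∃ b, Sum.inr b ∈ S
      · obtain ⟨b, hb⟩ := h
        refine Or.inr ⟨S.toRight, fun u hu v hv => hS (Sum.inr u) (by simpa using hu) (Sum.inr v)
          (by simpa using hv), ?_⟩
        ext (x | x)
        · have : Sum.inl x ∉ S := fun hx => hS _ hx _ hb trivial
          simp [this]
        · simp
      · refine Or.inl ⟨S.toLeft, fun u hu v hv => hS (Sum.inl u) (by simpa using hu) (Sum.inl v)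
          (by simpa using hv), ?_⟩
        ext (x | x)
        · simp
        · have : Sum.inr x ∉ S := fun hx => h ⟨x, hx⟩
          simp [this]
    · rintro (⟨s, hs, rfl⟩ | ⟨s, hs, rfl⟩) u hu v hv
      · simp only [Finset.mem_map] at hu hv
        obtain ⟨a, ha, rfl⟩ := hu
        obtain ⟨b, hb, rfl⟩ := hv
        exact hs a ha b hb
      · simp only [Finset.mem_map] at hu hv
        obtain ⟨a, ha, rfl⟩ := hu
        obtain ⟨b, hb, rfl⟩ := hv
        exact hs a ha b hb
  have hinter : (Finset.univ.filter fun s => G.IsIndepFinset s).map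
        (Finset.mapEmbedding (Function.Embedding.inl : α ↪ α ⊕ β)).toEmbedding ∩
      (Finset.univ.filter fun s => H.IsIndepFinset s).map
        (Finset.mapEmbedding Function.Embedding.inr).toEmbedding = {∅} := by
    ext S
    simp only [Finset.mem_filter, Finset.mem_univ, true_and, Finset.mem_inter, Finset.mem_map,
      RelEmbedding.coe_toEmbedding, Finset.mapEmbedding_apply, Finset.mem_singleton]
    constructor
    · rintro ⟨⟨s, -, rfl⟩, t, -, ht⟩
      ext (x | x)
      · rw [← ht]
        simp
      · simp
    · rintro rfl
      exact ⟨⟨∅, by simp [SimpleGraph.IsIndepFinset], rfl⟩,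
        ∅, by simp [SimpleGraph.IsIndepFinset], rfl⟩
  have h := Finset.sum_union_inter (f := fun S : Finset (α ⊕ β) => z ^ S.card)
    (s₁ := (Finset.univ.filter fun s => G.IsIndepFinset s).map
        (Finset.mapEmbedding (Function.Embedding.inl : α ↪ α ⊕ β)).toEmbedding)
    (s₂ := (Finset.univ.filter fun s => H.IsIndepFinset s).map
        (Finset.mapEmbedding Function.Embedding.inr).toEmbedding)
  rw [hinter] at h
  rw [hunion, eq_sub_iff_add_eq]
  simpa using h

theorem lexProd_top_isIndepFinset_iff {α β : Type} (G : SimpleGraph α) (S : Finset (α × β)) :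
    (lexProd G (⊤ : SimpleGraph β)).IsIndepFinset S ↔
      G.IsIndepFinset (S.image Prod.fst) ∧ Set.InjOn Prod.fst (S : Set (α × β)) := by
  constructor
  · intro h
    refine ⟨?_, ?_⟩
    · intro u hu v hv huv
      obtain ⟨x, hx, rfl⟩ := Finset.mem_image.1 hu
      obtain ⟨y, hy, rfl⟩ := Finset.mem_image.1 hv
      exact h x hx y hy (Or.inl huv)
    · intro x hx y hy hxy
      by_contra hne
      exact h x hx y hy (Or.inr ⟨hxy, fun h2 => hne (Prod.ext hxy h2)⟩)
  · rintro ⟨h, hinj⟩ x hx y hy (hxy | ⟨h1, h2⟩)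
    · exact h _ (Finset.mem_image_of_mem _ hx) _ (Finset.mem_image_of_mem _ hy) hxy
    · exact h2 (congrArg Prod.snd (hinj hx hy h1))

theorem card_filter_image_fst_eq {α β : Type} [Fintype α] [Fintype β] (s : Finset α) :
    (Finset.univ.filter fun S : Finset (α × β) =>
      Set.InjOn Prod.fst (S : Set (α × β)) ∧ S.image Prod.fst = s).card =
      Fintype.card β ^ s.card := by
  rw [← Fintype.card_coe s, ← Fintype.card_fun, ← Finset.card_univ]
  symm
  refine Finset.card_bij (fun f _ => Finset.univ.image fun a : s => ((a : α), f a)) ?_ ?_ ?_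
  · intro f _
    simp only [Finset.mem_filter, Finset.mem_univ, true_and]
    refine ⟨?_, ?_⟩
    · intro x hx y hy hxy
      simp only [Finset.coe_image, Finset.coe_univ, Set.image_univ, Set.mem_range] at hx hy
      obtain ⟨a, rfl⟩ := hx
      obtain ⟨b, rfl⟩ := hy
      rw [Subtype.ext hxy]
    · ext a
      simp
  · intro f _ g _ hfg
    funext a
    have : ((a : α), f a) ∈ Finset.univ.image fun a : s => ((a : α), g a) := by
      rw [← hfg]
      exact Finset.mem_image_of_mem _ (Finset.mem_univ a)
    obtain ⟨b, -, hb⟩ := Finset.mem_image.1 this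
    obtain rfl : b = a := Subtype.ext (congrArg Prod.fst hb)
    exact (congrArg Prod.snd hb).symm
  · intro S hS
    obtain ⟨-, hinj, rfl⟩ := Finset.mem_filter.1 hS
    have hex : ∀ a : S.image Prod.fst, ∃ b, ((a : α), b) ∈ S := by
      rintro ⟨a, ha⟩
      simpa using ha
    choose f hf using hex
    refine ⟨f, Finset.mem_univ _, ?_⟩
    ext x
    simp only [Finset.mem_image, Finset.mem_univ, true_and]
    constructor
    · rintro ⟨a, rfl⟩
      exact hf a
    · intro hx
      exact ⟨⟨x.1, Finset.mem_image_of_mem _ hx⟩, hinj (hf _) hx rfl⟩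

theorem lexProd_top_indepPoly_eval {α β : Type} [Fintype α] [Fintype β] (G : SimpleGraph α)
    (z : ℂ) :
    (indepPoly (lexProd G (⊤ : SimpleGraph β))).eval z =
      (indepPoly G).eval (Fintype.card β * z) := by
  rw [indepPoly_eval, indepPoly_eval, ← Finset.sum_fiberwise_of_maps_to
    (t := Finset.univ.filter fun s : Finset α => G.IsIndepFinset s)
    (g := fun S : Finset (α × β) => S.image Prod.fst)
    (fun S hS => by simpa using
      ((lexProd_top_isIndepFinset_iff G S).1 (Finset.mem_filter.1 hS).2).1)]
  refine Finset.sum_congr rfl fun s hs => ?_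
  have hs' : G.IsIndepFinset s := (Finset.mem_filter.1 hs).2
  have hfilter : ((Finset.univ.filter fun S : Finset (α × β) =>
      (lexProd G (⊤ : SimpleGraph β)).IsIndepFinset S).filter
        fun S => S.image Prod.fst = s) =
      Finset.univ.filter fun S : Finset (α × β) =>
        Set.InjOn Prod.fst (S : Set (α × β)) ∧ S.image Prod.fst = s := by
    ext S
    simp only [Finset.mem_filter, Finset.mem_univ, true_and, lexProd_top_isIndepFinset_iff]
    constructor
    · rintro ⟨⟨-, h⟩, h'⟩
      exact ⟨h, h'⟩
    · rintro ⟨h, rfl⟩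
      exact ⟨⟨hs', h⟩, rfl⟩
  rw [hfilter, mul_pow, ← Nat.cast_pow, ← card_filter_image_fst_eq, ← nsmul_eq_mul]
  refine Finset.sum_eq_card_nsmul fun S hS => ?_
  obtain ⟨-, hinj, rfl⟩ := Finset.mem_filter.1 hS
  rw [Finset.card_image_of_injOn hinj]

theorem bot_indepPoly_eval (m : ℕ) (z : ℂ) :
    (indepPoly (⊥ : SimpleGraph (Fin m))).eval z = (z + 1) ^ m := by
  have h := Fintype.sum_pow_mul_eq_add_pow (Fin m) z 1
  simpa [indepPoly_eval, SimpleGraph.IsIndepFinset] using h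

theorem graphJoin_connected {α β : Type} [Nonempty α] [Nonempty β] (G : SimpleGraph α)
    (H : SimpleGraph β) : (graphJoin G H).Connected := by
  have hlr (a : α) (b : β) : (graphJoin G H).Reachable (Sum.inl a) (Sum.inr b) :=
    SimpleGraph.Adj.reachable (G := graphJoin G H) trivial
  obtain ⟨a₀⟩ := ‹Nonempty α›
  obtain ⟨b₀⟩ := ‹Nonempty β›
  have : Nonempty (α ⊕ β) := ⟨Sum.inl a₀⟩
  refine ⟨?_⟩
  rintro (a | a) (b | b)
  · exact (hlr a b₀).trans (hlr b b₀).symm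
  · exact hlr a b
  · exact (hlr b a).symm
  · exact (hlr a₀ a).symm.trans (hlr a₀ b)

/-- `w` is the value at `z` of `I(F, x) - 1` for some nonempty finite graph `F`. -/
def IsReducedIndepValue (z w : ℂ) : Prop :=
  ∃ (W : Type) (_ : Fintype W) (_ : Nonempty W) (F : SimpleGraph W),
    (indepPoly F).eval z - 1 = w

theorem IsReducedIndepValue.add {z v w : ℂ} (hv : IsReducedIndepValue z v)
    (hw : IsReducedIndepValue z w) : IsReducedIndepValue z (v + w) := by
  obtain ⟨A, _, _, F, rfl⟩ := hv
  obtain ⟨B, _, _, K, rfl⟩ := hw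
  refine ⟨A ⊕ B, inferInstance, inferInstance, graphJoin F K, ?_⟩
  rw [graphJoin_indepPoly_eval]
  ring

theorem IsReducedIndepValue.nat_mul {z v : ℂ} (h0 : IsReducedIndepValue z 0)
    (hv : IsReducedIndepValue z v) (n : ℕ) : IsReducedIndepValue z (n * v) := by
  induction n with
  | zero => simpa using h0
  | succ n ih =>
    rw [Nat.cast_succ, add_one_mul]
    exact ih.add hv

theorem IsReducedIndepValue.int_mul {z v : ℂ} (hv : IsReducedIndepValue z v)
    (hv' : IsReducedIndepValue z (-v)) (n : ℤ) : IsReducedIndepValue z (n * v) := by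
  have h0 : IsReducedIndepValue z 0 := by simpa using hv.add hv'
  obtain ⟨m, rfl | rfl⟩ := n.eq_nat_or_neg
  · simpa using h0.nat_mul hv m
  · simpa using h0.nat_mul hv' m

theorem isReducedIndepValue_pow_sub_one {n : ℕ} (hn : n ≠ 0) {m : ℕ} (hm : m ≠ 0) (z : ℂ) :
    IsReducedIndepValue z ((n * z + 1) ^ m - 1) := by
  have := NeZero.mk hn
  have := NeZero.mk hm
  refine ⟨Fin m × Fin n, inferInstance, inferInstance, lexProd ⊥ ⊤, ?_⟩
  rw [lexProd_top_indepPoly_eval, bot_indepPoly_eval, Fintype.card_fin]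

theorem isReducedIndepValue_gaussianInt {n : ℕ} (hn : n ≠ 0) (a b : ℤ) :
    IsReducedIndepValue (Complex.I / n) (a + b * Complex.I) := by
  have hz : (n : ℂ) * (Complex.I / n) = Complex.I := by
    field_simp
  have hpow {m : ℕ} (hm : m ≠ 0) :
      IsReducedIndepValue (Complex.I / n) ((Complex.I + 1) ^ m - 1) := by
    simpa only [hz] using isReducedIndepValue_pow_sub_one hn hm (Complex.I / n)
  have h2 : (Complex.I + 1) ^ 2 = 2 * Complex.I := by
    linear_combination Complex.I_sq
  have hI : IsReducedIndepValue (Complex.I / n) Complex.I := by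
    simpa using hpow one_ne_zero
  have h6 : IsReducedIndepValue (Complex.I / n) (-1 - 8 * Complex.I) := by
    convert hpow (m := 2 * 3) (by norm_num) using 1
    rw [pow_mul (Complex.I + 1) 2 3, h2]
    linear_combination (-8 * Complex.I) * Complex.I_sq
  have h8 : IsReducedIndepValue (Complex.I / n) 15 := by
    convert hpow (m := 2 * 4) (by norm_num) using 1
    rw [pow_mul (Complex.I + 1) 2 4, h2, mul_pow, Complex.I_pow_four]
    norm_num
  have h2I := hI.add hI
  have h4I := h2I.add h2I
  have hneg : IsReducedIndepValue (Complex.I / n) (-1) := by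
    convert h6.add (h4I.add h4I) using 1
    ring
  have hneg2 := hneg.add hneg
  have hneg4 := hneg2.add hneg2
  have hone : IsReducedIndepValue (Complex.I / n) 1 := by
    convert h8.add ((hneg4.add hneg4).add (hneg4.add hneg2)) using 1
    ring
  have hnegI : IsReducedIndepValue (Complex.I / n) (-Complex.I) := by
    convert h6.add (hone.add (h4I.add (h2I.add hI))) using 1
    ring
  simpa using (hone.int_mul hneg a).add (hI.int_mul hnegI b)

theorem exists_indepPoly_eval_I_eq {V : Type} [Fintype V] (G : SimpleGraph V) :
    ∃ a b : ℤ, (indepPoly G).eval Complex.I = a + b * Complex.I := by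
  have hmem : (indepPoly G).eval Complex.I ∈ GaussianInt.toComplex.range := by
    rw [indepPoly_eval]
    have hI : Complex.I ∈ GaussianInt.toComplex.range :=
      ⟨⟨0, 1⟩, by simp [GaussianInt.toComplex_def]⟩
    exact sum_mem fun s _ => pow_mem hI _
  obtain ⟨g, hg⟩ := hmem
  exact ⟨g.re, g.im, by rw [← hg, GaussianInt.toComplex_def]⟩

/-- The copy of `G` inside the lexicographic product `G[H]` at a fixed vertex of `H`. -/
def lexProdEmbedding {α β : Type} (G : SimpleGraph α) (H : SimpleGraph β) (b : β) :
    G ↪g lexProd G H where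
  toFun a := (a, b)
  inj' _ _ h := congrArg Prod.fst h
  map_rel_iff' := by
    intro u v
    change G.Adj u v ∨ (u = v ∧ H.Adj b b) ↔ G.Adj u v
    simp

/-- The left summand as an induced subgraph of a join. -/
def graphJoinInl {α β : Type} (G : SimpleGraph α) (H : SimpleGraph β) : G ↪g graphJoin G H where
  toFun := Sum.inl
  inj' := Sum.inl_injective
  map_rel_iff' := Iff.rfl

theorem exists_connected_indepPoly_eval_eq_zero {n : ℕ} (hn : n ≠ 0) {V : Type} [Fintype V]
    (G : SimpleGraph V) :
    ∃ (m : ℕ) (H : SimpleGraph (Fin m)), H.Connected ∧ Nonempty (G ↪g H) ∧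
      (indepPoly H).eval (Complex.I / n) = 0 := by
  have := NeZero.mk hn
  have hz : (n : ℂ) * (Complex.I / n) = Complex.I := by
    field_simp
  obtain ⟨a, b, hab⟩ := exists_indepPoly_eval_I_eq G
  obtain ⟨A, _, _, F, hF⟩ := isReducedIndepValue_gaussianInt hn 0 0
  obtain ⟨B, _, _, K, hK⟩ := isReducedIndepValue_gaussianInt hn (-a) (-b)
  let J := graphJoin (graphJoin (lexProd G (⊤ : SimpleGraph (Fin n))) F) K
  let e := SimpleGraph.overFinIso J rfl
  refine ⟨_, J.overFin rfl, e.connected_iff.1 (graphJoin_connected _ _),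
    ⟨e.toEmbedding.comp ((graphJoinInl _ K).comp
      ((graphJoinInl _ F).comp (lexProdEmbedding G ⊤ 0)))⟩, ?_⟩
  rw [← indepPoly_eval_iso e, graphJoin_indepPoly_eval, graphJoin_indepPoly_eval,
    lexProd_top_indepPoly_eval, Fintype.card_fin, hz, hab]
  push_cast at hF hK
  linear_combination hF + hK

/-- For every nonzero integer `k`, every finite simple graph is an induced subgraph of a
connected finite simple graph having independence roots at `i/k` and `−i/k`. -/
theorem every_graph_induced_subgraph_of_graph_with_root (k : ℤ) (hk : k ≠ 0)
    {V : Type} [Fintype V] (G : SimpleGraph V) :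
    ∃ (m : ℕ) (H : SimpleGraph (Fin m)),
      H.Connected ∧ Nonempty (G ↪g H) ∧
      (indepPoly H).eval (Complex.I / k) = 0 ∧
      (indepPoly H).eval (-(Complex.I / k)) = 0 := by
  have hn : k.natAbs ≠ 0 := Int.natAbs_ne_zero.2 hk
  obtain ⟨m, H, hconn, hemb, hroot⟩ := exists_connected_indepPoly_eval_eq_zero hn G
  have hroot' : (indepPoly H).eval (-(Complex.I / k.natAbs)) = 0 := by
    have h := indepPoly_eval_conj H (Complex.I / k.natAbs)
    rw [hroot, map_zero] at h
    simpa [neg_div] using h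
  refine ⟨m, H, hconn, hemb, ?_⟩
  have hcast : (k : ℂ) = (k.natAbs : ℂ) ∨ (k : ℂ) = -(k.natAbs : ℂ) := by
    rcases Int.natAbs_eq k with h | h
    · exact Or.inl (by simpa only [Int.cast_natCast] using congrArg (Int.cast : ℤ → ℂ) h)
    · exact Or.inr (by
        simpa only [Int.cast_neg, Int.cast_natCast] using congrArg (Int.cast : ℤ → ℂ) h)
  rcases hcast with h | h
  · rw [h]
    exact ⟨hroot, hroot'⟩
  · rw [h, div_neg, neg_neg]
    exact ⟨hroot', hroot⟩
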